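/- Converse direction of the Lax-pair equivalence for the 1D image metamorphosis system: Let u, ρ : ℝ × ℝ → ℝ be smooth functions with ρ nowhere zero, and set m := u − ∂ₓ²u. Suppose there are two distinct nonzero real numbers λ₁ ≠ λ₂ and smooth nowhere-vanishing functions ψ₁, ψ₂ : ℝ × ℝ → ℝ such that for each i ∈ {1,2}, ψᵢ satisfies both the eigenvalue equation ∂ₓ²ψᵢ + (−1/4 + m λᵢ + ρ² λᵢ²) ψᵢ = 0 and the evolution equation ∂_t ψᵢ = −(1/(2λᵢ) + u) ∂ₓ ψᵢ + (1/2)(∂ₓ u) ψᵢ at every point. Then (u, ρ) satisfies the 1D image-metamorphosis system: ∂_t m + u ∂ₓ m + 2 m ∂ₓ u = −ρ ∂ₓ ρ and ∂_t ρ + ∂ₓ(ρ u) = 0 at every point. -/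

import Mathlib

/-!
Statement 6: converse direction of the Lax-pair equivalence for the 1D image
metamorphosis system: if for two distinct nonzero spectral parameters `λ₁ ≠ λ₂`
there are smooth nowhere-vanishing solutions `ψ₁, ψ₂` of both the eigenvalue
equation `∂ₓ²ψᵢ + (−1/4 + mλᵢ + ρ²λᵢ²)ψᵢ = 0` and the evolution equation
`∂ₜψᵢ = −(1/(2λᵢ) + u)∂ₓψᵢ + ½(∂ₓu)ψᵢ`, and `ρ` is nowhere zero, then `(u, ρ)`
satisfies the 1D image-metamorphosis system (SDPsystem1D).
-/

noncomputable section

/-- Partial derivative in the first (time) variable. -/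
def pt (f : ℝ × ℝ → ℝ) (p : ℝ × ℝ) : ℝ := deriv (fun s => f (s, p.2)) p.1

/-- Partial derivative in the second (space) variable. -/
def px (f : ℝ × ℝ → ℝ) (p : ℝ × ℝ) : ℝ := deriv (fun y => f (p.1, y)) p.2

theorem px_fd {f : ℝ × ℝ → ℝ} (hf : ContDiff ℝ (⊤ : ℕ∞) f) (p : ℝ × ℝ) :
    HasDerivAt (fun y => f (p.1, y)) (fderiv ℝ f p (0, 1)) p.2 := by
  have h := (hf.differentiable (by simp) p).hasFDerivAt
  exact h.comp_hasDerivAt p.2 ((hasDerivAt_const p.2 p.1).prodMk (hasDerivAt_id p.2))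

theorem pt_fd {f : ℝ × ℝ → ℝ} (hf : ContDiff ℝ (⊤ : ℕ∞) f) (p : ℝ × ℝ) :
    HasDerivAt (fun s => f (s, p.2)) (fderiv ℝ f p (1, 0)) p.1 := by
  have h := (hf.differentiable (by simp) p).hasFDerivAt
  exact h.comp_hasDerivAt p.1 ((hasDerivAt_id p.1).prodMk (hasDerivAt_const p.1 p.2))

theorem px_eq {f : ℝ × ℝ → ℝ} (hf : ContDiff ℝ (⊤ : ℕ∞) f) :
    px f = fun p => fderiv ℝ f p (0, 1) := funext fun p => (px_fd hf p).deriv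

theorem pt_eq {f : ℝ × ℝ → ℝ} (hf : ContDiff ℝ (⊤ : ℕ∞) f) :
    pt f = fun p => fderiv ℝ f p (1, 0) := funext fun p => (pt_fd hf p).deriv

theorem px_has {f : ℝ × ℝ → ℝ} (hf : ContDiff ℝ (⊤ : ℕ∞) f) (p : ℝ × ℝ) :
    HasDerivAt (fun y => f (p.1, y)) (px f p) p.2 := by
  rw [px_eq hf]; exact px_fd hf p

theorem pt_has {f : ℝ × ℝ → ℝ} (hf : ContDiff ℝ (⊤ : ℕ∞) f) (p : ℝ × ℝ) :
    HasDerivAt (fun s => f (s, p.2)) (pt f p) p.1 := by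
  rw [pt_eq hf]; exact pt_fd hf p

theorem fd_smooth {f : ℝ × ℝ → ℝ} (hf : ContDiff ℝ (⊤ : ℕ∞) f) :
    ContDiff ℝ (⊤ : ℕ∞) (fderiv ℝ f) := hf.fderiv_right (by simp)

theorem px_smooth {f : ℝ × ℝ → ℝ} (hf : ContDiff ℝ (⊤ : ℕ∞) f) :
    ContDiff ℝ (⊤ : ℕ∞) (px f) := by
  rw [px_eq hf]; exact (fd_smooth hf).clm_apply contDiff_const

theorem pt_smooth {f : ℝ × ℝ → ℝ} (hf : ContDiff ℝ (⊤ : ℕ∞) f) :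
    ContDiff ℝ (⊤ : ℕ∞) (pt f) := by
  rw [pt_eq hf]; exact (fd_smooth hf).clm_apply contDiff_const

theorem pt_px {f : ℝ × ℝ → ℝ} (hf : ContDiff ℝ (⊤ : ℕ∞) f) (p : ℝ × ℝ) :
    pt (px f) p = px (pt f) p := by
  rw [pt_eq (px_smooth hf), px_eq (pt_smooth hf), px_eq hf, pt_eq hf]
  have hd : DifferentiableAt ℝ (fderiv ℝ f) p := (fd_smooth hf).differentiable (by simp) p
  have hs : IsSymmSndFDerivAt ℝ f p :=
    hf.contDiffAt.isSymmSndFDerivAt (by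
      simp only [minSmoothness_of_isRCLikeNormedField]; exact WithTop.coe_le_coe.2 (le_top : (2 : ℕ∞) ≤ ⊤))
  have e : ∀ v w : ℝ × ℝ, fderiv ℝ (fun q => fderiv ℝ f q v) p w
      = fderiv ℝ (fderiv ℝ f) p w v := by
    intro v w
    rw [fderiv_clm_apply hd (differentiableAt_const v)]
    simp
  simp only [e]
  exact hs _ _

theorem key {u ρ m ψ : ℝ × ℝ → ℝ} {l : ℝ}
    (hu : ContDiff ℝ (⊤ : ℕ∞) u) (hρ : ContDiff ℝ (⊤ : ℕ∞) ρ)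
    (hm : m = fun p => u p - px (px u) p) (hl : l ≠ 0)
    (hψ : ContDiff ℝ (⊤ : ℕ∞) ψ) (hψ0 : ∀ p, ψ p ≠ 0)
    (heig : ∀ p, px (px ψ) p
        + (-(1 / 4) + m p * l + (ρ p) ^ 2 * l ^ 2) * ψ p = 0)
    (hev : ∀ p, pt ψ p
        = -((1 / (2 * l) + u p) * px ψ p) + (1 / 2) * px u p * ψ p) (p : ℝ × ℝ) :
    (pt m p + u p * px m p + 2 * m p * px u p + ρ p * px ρ p)
      + 2 * l * (ρ p * (pt ρ p + (px ρ p * u p + ρ p * px u p))) = 0 := by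
  have hms : ContDiff ℝ (⊤ : ℕ∞) m := by
    rw [hm]; exact hu.sub (px_smooth (px_smooth hu))
  have hpm : px m p = px u p - px (px (px u)) p := by
    conv_lhs => rw [hm]
    exact ((px_has hu p).sub (px_has (px_smooth (px_smooth hu)) p)).deriv
  have hE : px (px ψ) = fun p => -((-(1 / 4) + m p * l + (ρ p) ^ 2 * l ^ 2) * ψ p) :=
    funext fun p => by linarith [heig p]
  have hV : pt ψ = fun p => -((1 / (2 * l) + u p) * px ψ p) + (1 / 2) * px u p * ψ p :=
    funext hev
  have sψ := px_smooth hψ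
  have su := px_smooth hu
  have h1 : pt (px (px ψ)) p = px (px (pt ψ)) p := by
    rw [pt_px sψ, show pt (px ψ) = px (pt ψ) from funext (pt_px hψ)]
  have hV1 : px (pt ψ) = fun p => -(px u p * px ψ p + (1 / (2 * l) + u p) * px (px ψ) p)
      + ((1 / 2) * px (px u) p * ψ p + (1 / 2) * px u p * px ψ p) := by
    funext q
    conv_lhs => rw [hV]
    exact (((((px_has hu q).const_add (1 / (2 * l))).mul (px_has sψ q)).neg).add
      (((px_has su q).const_mul (1 / 2)).mul (px_has hψ q))).deriv
  have hV2 : px (px (pt ψ)) p = -((px (px u) p * px ψ p + px u p * px (px ψ) p)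
        + (px u p * px (px ψ) p + (1 / (2 * l) + u p) * px (px (px ψ)) p))
      + (((1 / 2) * px (px (px u)) p * ψ p + (1 / 2) * px (px u) p * px ψ p)
       + ((1 / 2) * px (px u) p * px ψ p + (1 / 2) * px u p * px (px ψ) p)) := by
    rw [hV1]
    exact (((((px_has su p).mul (px_has sψ p)).add
      (((px_has hu p).const_add (1 / (2 * l))).mul (px_has (px_smooth sψ) p))).neg).add
      ((((px_has (px_smooth su) p).const_mul (1 / 2)).mul (px_has hψ p)).add
      (((px_has su p).const_mul (1 / 2)).mul (px_has sψ p)))).deriv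
  have hE1 : px (px (px ψ)) p = -((px m p * l + (2 * ρ p * px ρ p) * l ^ 2) * ψ p
      + (-(1 / 4) + m p * l + (ρ p) ^ 2 * l ^ 2) * px ψ p) := by
    conv_lhs => rw [hE]
    refine HasDerivAt.deriv ?_
    convert (((((px_has hms p).mul_const l).const_add (-(1 / 4))).add
      (((px_has hρ p).pow 2).mul_const (l ^ 2))).mul (px_has hψ p)).neg using 1
    · rfl
    · simp [Pi.add_apply]
  have hE2 : pt (px (px ψ)) p = -((pt m p * l + (2 * ρ p * pt ρ p) * l ^ 2) * ψ p
      + (-(1 / 4) + m p * l + (ρ p) ^ 2 * l ^ 2) * pt ψ p) := by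
    conv_lhs => rw [hE]
    refine HasDerivAt.deriv ?_
    convert (((((pt_has hms p).mul_const l).const_add (-(1 / 4))).add
      (((pt_has hρ p).pow 2).mul_const (l ^ 2))).mul (pt_has hψ p)).neg using 1
    · rfl
    · simp [Pi.add_apply]
  have hE0 := heig p
  have hE0' : px (px ψ) p = -((-(1 / 4) + m p * l + (ρ p) ^ 2 * l ^ 2) * ψ p) := by linarith
  have hu3 : px (px (px u)) p = px u p - px m p := by linarith
  rw [hE2, hV2, hE1, hE0', hev p, hu3] at h1
  obtain ⟨k, hk⟩ : ∃ k, k = 1 / (2 * l) := ⟨_, rfl⟩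
  have hkl : 2 * k * l = 1 := by rw [hk]; field_simp
  rw [← hk] at h1
  apply mul_left_cancel₀ (mul_ne_zero hl (hψ0 p))
  linear_combination (-1) * h1 - (px m p + 2 * ρ p * px ρ p * l) * ψ p * hkl / 2

theorem lax_pair_converse
    (u ρ : ℝ × ℝ → ℝ)
    (hu : ContDiff ℝ (⊤ : ℕ∞) u) (hρ : ContDiff ℝ (⊤ : ℕ∞) ρ)
    (hρ0 : ∀ p, ρ p ≠ 0)
    (m : ℝ × ℝ → ℝ) (hm : m = fun p => u p - px (px u) p)
    (l₁ l₂ : ℝ) (hl₁ : l₁ ≠ 0) (hl₂ : l₂ ≠ 0) (hll : l₁ ≠ l₂)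
    (ψ₁ ψ₂ : ℝ × ℝ → ℝ)
    (hψ₁ : ContDiff ℝ (⊤ : ℕ∞) ψ₁) (hψ₂ : ContDiff ℝ (⊤ : ℕ∞) ψ₂)
    (hψ₁0 : ∀ p, ψ₁ p ≠ 0) (hψ₂0 : ∀ p, ψ₂ p ≠ 0)
    -- the eigenvalue equations
    (heig₁ : ∀ p, px (px ψ₁) p
        + (-(1 / 4) + m p * l₁ + (ρ p) ^ 2 * l₁ ^ 2) * ψ₁ p = 0)
    (heig₂ : ∀ p, px (px ψ₂) p
        + (-(1 / 4) + m p * l₂ + (ρ p) ^ 2 * l₂ ^ 2) * ψ₂ p = 0)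
    -- the evolution equations
    (hev₁ : ∀ p, pt ψ₁ p
        = -((1 / (2 * l₁) + u p) * px ψ₁ p) + (1 / 2) * px u p * ψ₁ p)
    (hev₂ : ∀ p, pt ψ₂ p
        = -((1 / (2 * l₂) + u p) * px ψ₂ p) + (1 / 2) * px u p * ψ₂ p) :
    -- conclusion: the 1D image-metamorphosis system holds
    (∀ p, pt m p + u p * px m p + 2 * m p * px u p = -(ρ p * px ρ p))
    ∧ (∀ p, pt ρ p + px (fun q => ρ q * u q) p = 0) := by
  have k1 := key hu hρ hm hl₁ hψ₁ hψ₁0 heig₁ hev₁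
  have k2 := key hu hρ hm hl₂ hψ₂ hψ₂0 heig₂ hev₂
  have hB : ∀ p, pt ρ p + (px ρ p * u p + ρ p * px u p) = 0 := by
    intro p
    have h : (l₁ - l₂) * (ρ p * (pt ρ p + (px ρ p * u p + ρ p * px u p))) = 0 := by
      linear_combination (k1 p - k2 p) / 2
    exact ((mul_eq_zero.1 h).resolve_left (sub_ne_zero.2 hll) |> mul_eq_zero.1).resolve_left
      (hρ0 p)
  refine ⟨fun p => ?_, fun p => ?_⟩
  · have h := k1 p
    rw [hB p] at h
    linarith
  · have h : px (fun q => ρ q * u q) p = px ρ p * u p + ρ p * px u p :=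
      ((px_has hρ p).mul (px_has hu p)).deriv
    rw [h]
    exact hB p
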